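/- Let Q be a finite set and let E = Q^n be equipped with the Hamming distance. Define a 'half-space' in E to be a subset of the form H_{i,α} = {x ∈ E | π_i(x) ≠ α} for some coordinate i (1 ≤ i ≤ n) and some α ∈ Q. Then for any finite nonempty subset S ⊆ E, the convex hull hull(S) equals the intersection of all half-spaces H_{i,α} that contain S. -/

import Mathlib

variable {Q : Type*} [Fintype Q] [DecidableEq Q] {n : ℕ}

/-- The metric segment `[x,y]` in the Hamming space `Q^n`. -/
def hammingSeg (x y : Fin n → Q) : Set (Fin n → Q) :=
  {z | hammingDist x y = hammingDist x z + hammingDist z y}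

/-- A subset `K ⊆ Q^n` is convex (for the Hamming metric) if it contains the segment
between any two of its points. -/
def HammingConvex (K : Set (Fin n → Q)) : Prop :=
  ∀ x ∈ K, ∀ y ∈ K, hammingSeg x y ⊆ K

/-- The convex hull of `S ⊆ Q^n`: the smallest Hamming-convex set containing `S`. -/
def hammingHull (S : Set (Fin n → Q)) : Set (Fin n → Q) :=
  ⋂₀ {K : Set (Fin n → Q) | HammingConvex K ∧ S ⊆ K}

/-- Segments in the Hamming space are coordinatewise. -/
theorem mem_hammingSeg_iff {R : Type*} [DecidableEq R] {m : ℕ} {x y z : Fin m → R} :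
    z ∈ hammingSeg x y ↔ ∀ i, z i = x i ∨ z i = y i := by
  have hle : ∀ i ∈ (Finset.univ : Finset (Fin m)),
      (if x i ≠ y i then 1 else 0) ≤
        (if x i ≠ z i then 1 else 0) + (if z i ≠ y i then 1 else 0) := by
    intro i _
    split_ifs <;> simp_all
  simp only [hammingSeg, Set.mem_ofPred_eq, hammingDist, Finset.card_filter,
    ← Finset.sum_add_distrib]
  rw [Finset.sum_eq_sum_iff_of_le hle]
  refine forall_congr' fun i => ?_
  simp only [Finset.mem_univ, forall_const]
  split_ifs <;> grind

theorem hammingConvex_halfSpace {R : Type*} [DecidableEq R] {m : ℕ} (i : Fin m) (a : R) :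
    HammingConvex {x : Fin m → R | x i ≠ a} := by
  intro x hx y hy z hz
  rcases mem_hammingSeg_iff.1 hz i with h | h
  · exact fun hza => hx (h ▸ hza)
  · exact fun hza => hy (h ▸ hza)

/-- A convex set contains every point each of whose coordinates is attained in the set. -/
theorem HammingConvex.mem_of_forall_exists_eq {R : Type*} [DecidableEq R] {m : ℕ}
    {K : Set (Fin m → R)} (hK : HammingConvex K) (hne : K.Nonempty) {x : Fin m → R}
    (hx : ∀ i, ∃ s ∈ K, s i = x i) : x ∈ K := by
  have key : ∀ A : Finset (Fin m), ∃ y ∈ K, ∀ i ∈ A, y i = x i := by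
    intro A
    induction A using Finset.induction_on with
    | empty => simpa [Set.Nonempty] using hne
    | insert i A _ ih =>
      obtain ⟨y, hy, hyA⟩ := ih
      obtain ⟨s, hs, hsi⟩ := hx i
      refine ⟨Function.update y i (x i), hK y hy s hs (mem_hammingSeg_iff.2 fun j => ?_),
        fun j hj => ?_⟩
      · by_cases hji : j = i
        · subst hji
          simp [hsi]
        · simp [hji]
      · by_cases hji : j = i
        · subst hji
          simp
        · simpa [hji] using hyA j (Finset.mem_of_mem_insert_of_ne hj hji)
  obtain ⟨y, hy, hyx⟩ := key Finset.univ
  rwa [← funext fun i => hyx i (Finset.mem_univ i)]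

/-- Discrete Hahn–Banach property (P1): for a finite nonempty `S ⊆ Q^n`, the convex hull
of `S` equals the intersection of all "half-spaces" `H_{i,α} = {x | π_i(x) ≠ α}`
containing `S`. -/
theorem hammingHull_eq_sInter_halfSpaces (S : Set (Fin n → Q))
    (hfin : S.Finite) (hne : S.Nonempty) :
    hammingHull S =
      ⋂₀ {H : Set (Fin n → Q) |
            (∃ (i : Fin n) (α : Q), H = {x : Fin n → Q | x i ≠ α}) ∧ S ⊆ H} := by
  apply Set.Subset.antisymm
  · rintro x hx _ ⟨⟨i, a, rfl⟩, hS⟩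
    exact hx _ ⟨hammingConvex_halfSpace i a, hS⟩
  · rintro x hx K ⟨hK, hSK⟩
    refine hK.mem_of_forall_exists_eq (hne.mono hSK) fun i => ?_
    by_contra! h
    exact hx {y | y i ≠ x i} ⟨⟨i, x i, rfl⟩, fun s hs => h s (hSK hs)⟩ rfl
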